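/- arXiv:1104.1961 — 2 statements merged into one kernel-verified Lean document; each statement's English description precedes it below -/
import Mathlib

section
/- Let G be an abelian group and v a group automorphism of G. If g₁, g₂ ∈ G have finite v-orbits of cardinalities n₁ and n₂, then there exists g ∈ G whose v-orbit has cardinality lcm(n₁, n₂). Consequently, the set L(G,v) = {#orbit(g) : g ∈ G, g ≠ 0, orbit finite} is closed under taking least common multiples. -/
/-- `L(G,v)`: the set of cardinalities of finite `v`-orbits of nonzero elements of `G`.
The orbit cardinality of `g` is the least positive `n` with `vⁿ(g) = g`,
i.e. `Function.minimalPeriod ⇑v g` (positivity encodes finiteness of the orbit). -/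
def orbitCardSet {G : Type*} [AddCommGroup G] (v : AddAut G) : Set ℕ :=
  {n | 0 < n ∧ ∃ g : G, g ≠ 0 ∧ Function.minimalPeriod (⇑v) g = n}

lemma avoid_aux {R : Type*} [CommRing R] (x : R) (N : ℕ) (hN : 0 < N) (T : Finset ℕ)
    (hT : ∀ p ∈ T, p.Prime ∧ p ∣ N) (m : Ideal R) [m.IsMaximal] (hxN : x ^ N - 1 ∈ m)
    (hm : ∀ p ∈ T, x ^ (N / p) - 1 ∈ m → (p : R) ∈ m) (c : ℕ → R) :
    ∃ y : R, ∀ p ∈ T, y - c p ∉ m := by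
  classical
  letI : Field (R ⧸ m) := Ideal.Quotient.field m
  set z : R ⧸ m := Ideal.Quotient.mk m x with hz
  have hzN : z ^ N = 1 := by
    rw [← sub_eq_zero, hz, ← map_pow, ← map_one (Ideal.Quotient.mk m), ← map_sub]
    exact Ideal.Quotient.eq_zero_iff_mem.2 hxN
  have hzp : ∀ p ∈ T, z ^ (N / p) = 1 → (p : R ⧸ m) = 0 := by
    intro p hp h
    rw [← map_natCast (Ideal.Quotient.mk m), Ideal.Quotient.eq_zero_iff_mem]
    apply hm p hp
    rw [← Ideal.Quotient.eq_zero_iff_mem, map_sub, map_pow, map_one, ← hz, h, sub_self]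
  have hdN : orderOf z ∣ N := orderOf_dvd_of_pow_eq_one hzN
  have hd : 0 < orderOf z := Nat.pos_of_dvd_of_pos hdN hN
  have hz0 : z ≠ 0 := by
    intro h
    rw [h, zero_pow hN.ne'] at hzN
    exact zero_ne_one hzN
  have hsub : T ⊆ (Finset.Icc 2 (orderOf z)) ∪ T.filter (fun p : ℕ => (p : R ⧸ m) = 0) := by
    intro p hp
    rw [Finset.mem_union, Finset.mem_filter, Finset.mem_Icc]
    by_cases h0 : (p : R ⧸ m) = 0
    · exact Or.inr ⟨hp, h0⟩
    · left
      obtain ⟨hpp, hpN⟩ := hT p hp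
      refine ⟨hpp.two_le, Nat.le_of_dvd hd ?_⟩
      by_contra hnd
      apply h0
      apply hzp p hp
      apply orderOf_dvd_iff_pow_eq_one.1
      obtain ⟨k, rfl⟩ := hpN
      rw [Nat.mul_div_cancel_left _ hpp.pos]
      exact Nat.Coprime.dvd_of_dvd_mul_left ((Nat.Prime.coprime_iff_not_dvd hpp).2 hnd).symm hdN
  have hone : (T.filter (fun p : ℕ => (p : R ⧸ m) = 0)).card ≤ 1 := by
    rw [Finset.card_le_one]
    intro a ha b hb
    rw [Finset.mem_filter] at ha hb
    by_contra hab
    have hc := (Nat.coprime_primes (hT a ha.1).1 (hT b hb.1).1).2 hab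
    have hi := Nat.isCoprime_iff_coprime.2 hc
    obtain ⟨u, w, huw⟩ := hi
    have := congrArg (Int.cast : ℤ → R ⧸ m) huw
    push_cast at this
    rw [ha.2, hb.2] at this
    simp at this
  have hcard : T.card ≤ orderOf z := by
    have h1 := (Finset.card_le_card hsub).trans (Finset.card_union_le _ _)
    rw [Nat.card_Icc] at h1
    omega
  let P : Finset (R ⧸ m) := insert 0 ((Finset.range (orderOf z)).image (fun i => z ^ i))
  have hP : P.card = orderOf z + 1 := by
    rw [Finset.card_insert_of_notMem, Finset.card_image_of_injOn, Finset.card_range]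
    · intro i hi j hj hij
      exact pow_injOn_Iio_orderOf (by simpa using hi) (by simpa using hj) hij
    · simp only [Finset.mem_image, not_exists, not_and]
      intro i _ h
      exact pow_ne_zero i hz0 h
  obtain ⟨w, -, hw⟩ := Finset.exists_mem_notMem_of_card_lt_card
    (s := T.image (fun p => Ideal.Quotient.mk m (c p))) (t := P)
    (by have := Finset.card_image_le (s := T) (f := fun p => Ideal.Quotient.mk m (c p)); omega)
  obtain ⟨y, rfl⟩ := Ideal.Quotient.mk_surjective w
  refine ⟨y, fun p hp h => hw ?_⟩
  rw [Finset.mem_image]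
  exact ⟨p, hp, ((Ideal.Quotient.mk_eq_mk_iff_sub_mem _ _).2 h).symm⟩

lemma avoid_all {R : Type*} [CommRing R] (x : R) (N : ℕ) (hN : 0 < N) (T : Finset ℕ)
    (hT : ∀ p ∈ T, p.Prime ∧ p ∣ N) (m : ℕ → Ideal R) (hmax : ∀ p ∈ T, (m p).IsMaximal)
    (hxN : ∀ p ∈ T, x ^ N - 1 ∈ m p)
    (hm : ∀ p ∈ T, x ^ (N / p) - 1 ∈ m p → (p : R) ∈ m p) (c : ℕ → R) :
    ∃ y : R, ∀ p ∈ T, y - c p ∉ m p := by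
  classical
  have h1 : ∀ I : {I // I ∈ T.image m}, ∃ y : R, ∀ p ∈ T.filter (fun p => m p = I.1),
      y - c p ∉ I.1 := by
    rintro ⟨I, hI⟩
    obtain ⟨p₀, hp₀, rfl⟩ := Finset.mem_image.1 hI
    haveI := hmax p₀ hp₀
    refine avoid_aux x N hN _ (fun p hp => hT p (Finset.mem_filter.1 hp).1) (m p₀)
      (hxN p₀ hp₀) ?_ c
    intro p hp h
    obtain ⟨hp1, hp2⟩ := Finset.mem_filter.1 hp
    simp only at hp2
    rw [← hp2] at h ⊢
    exact hm p hp1 h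
  choose f hf using h1
  have hcop : Pairwise fun I J : {I // I ∈ T.image m} => IsCoprime I.1 J.1 := by
    rintro ⟨I, hI⟩ ⟨J, hJ⟩ hIJ
    obtain ⟨p, hp, rfl⟩ := Finset.mem_image.1 hI
    obtain ⟨q, hq, rfl⟩ := Finset.mem_image.1 hJ
    haveI := hmax p hp
    haveI := hmax q hq
    exact Ideal.isCoprime_of_isMaximal (fun h => hIJ (Subtype.ext h))
  obtain ⟨y, hy⟩ := Ideal.exists_forall_sub_mem_ideal
    (I := fun I : {I // I ∈ T.image m} => I.1) hcop f
  refine ⟨y, fun p hp h => ?_⟩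
  have hI : m p ∈ T.image m := Finset.mem_image_of_mem m hp
  refine hf ⟨m p, hI⟩ p (Finset.mem_filter.2 ⟨hp, rfl⟩) ?_
  have h2 := hy ⟨m p, hI⟩
  have h3 := (m p).sub_mem h h2
  simpa using h3

lemma key_module {R M : Type*} [CommRing R] [AddCommGroup M] [Module R M] (x : R) (v : M → M)
    (hv : ∀ n g, v^[n] g = x ^ n • g) (g₁ g₂ : M)
    (h₁ : 0 < Function.minimalPeriod v g₁) (h₂ : 0 < Function.minimalPeriod v g₂) :
    ∃ g, Function.minimalPeriod v g =
      Nat.lcm (Function.minimalPeriod v g₁) (Function.minimalPeriod v g₂) := by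
  classical
  have hper : ∀ n g, Function.minimalPeriod v g ∣ n ↔ x ^ n • g = g := by
    intro n g
    rw [← Function.isPeriodicPt_iff_minimalPeriod_dvd, Function.IsPeriodicPt,
      Function.IsFixedPt, hv]
  set N := Nat.lcm (Function.minimalPeriod v g₁) (Function.minimalPeriod v g₂) with hNdef
  have hN : 0 < N := Nat.lcm_pos h₁ h₂
  have hN1 := (hper N g₁).1 (Nat.dvd_lcm_left _ _)
  have hN2 := (hper N g₂).1 (Nat.dvd_lcm_right _ _)
  let h : ℕ → M := fun p => (x ^ (N / p) - 1) • g₂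
  let t : ℕ → M := fun p => -((x ^ (N / p) - 1) • g₁)
  let T := N.primeFactors.filter (fun p => h p ≠ 0)
  have hTm : ∀ p ∈ T, p.Prime ∧ p ∣ N := fun p hp =>
    ⟨Nat.prime_of_mem_primeFactors (Finset.mem_filter.1 hp).1,
      Nat.dvd_of_mem_primeFactors (Finset.mem_filter.1 hp).1⟩
  let A : ℕ → Ideal R := fun p => LinearMap.ker (LinearMap.toSpanSingleton R M (h p))
  have hA : ∀ p r, r ∈ A p ↔ r • h p = 0 := by
    intro p r
    simp [A]
  have hmax : ∀ p, ∃ m : Ideal R, p ∈ T → m.IsMaximal ∧ A p ≤ m := by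
    intro p
    by_cases hp : p ∈ T
    · obtain ⟨m, hm⟩ := Ideal.exists_le_maximal (A p) (by
        rw [Ideal.ne_top_iff_one, hA, one_smul]
        exact (Finset.mem_filter.1 hp).2)
      exact ⟨m, fun _ => hm⟩
    · exact ⟨⊤, fun h => absurd h hp⟩
  choose m hm using hmax
  have hc : ∀ p, ∃ c : R, ∀ y, p ∈ T → y • h p = t p → y - c ∈ m p := by
    intro p
    by_cases hex : ∃ c : R, c • h p = t p
    · obtain ⟨c, hc⟩ := hex
      refine ⟨c, fun y hp hy => (hm p hp).2 ?_⟩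
      rw [hA, sub_smul, hy, hc, sub_self]
    · exact ⟨0, fun y _ hy => absurd ⟨y, hy⟩ hex⟩
  choose c hc using hc
  obtain ⟨y, hy⟩ := avoid_all x N hN T hTm m (fun p hp => (hm p hp).1)
    (by
      intro p hp
      apply (hm p hp).2
      rw [hA]
      simp only [h]
      rw [smul_comm, sub_smul (x ^ N), hN2, one_smul, sub_self, smul_zero])
    (by
      intro p hp hx
      obtain ⟨hpp, hpN⟩ := hTm p hp
      have hsum : (∑ i ∈ Finset.range p, (x ^ (N / p)) ^ i) ∈ m p := by
        apply (hm p hp).2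
        rw [hA]
        simp only [h]
        rw [smul_smul, geom_sum_mul, ← pow_mul, Nat.div_mul_cancel hpN, sub_smul, hN2, one_smul,
          sub_self]
      rw [← Ideal.Quotient.eq_zero_iff_mem] at hx hsum ⊢
      rw [map_sub, map_one, sub_eq_zero] at hx
      rw [map_sum] at hsum
      simpa [map_pow (Ideal.Quotient.mk (m p)) (x ^ (N / p)), hx, -map_pow] using hsum) c
  refine ⟨g₁ + y • g₂, ?_⟩
  have hdvd : Function.minimalPeriod v (g₁ + y • g₂) ∣ N := by
    rw [hper, smul_add, smul_comm, hN1, hN2]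
  by_contra hne
  obtain ⟨k, hk⟩ := hdvd
  have hk1 : k ≠ 1 := by
    rintro rfl
    rw [mul_one] at hk
    exact hne hk.symm
  obtain ⟨p, hpp, l, rfl⟩ := Nat.exists_prime_and_dvd hk1
  have hNp : N = p * (Function.minimalPeriod v (g₁ + y • g₂) * l) := by rw [hk]; ring
  have hpN : p ∣ N := ⟨_, hNp⟩
  have hdiv : N / p = Function.minimalPeriod v (g₁ + y • g₂) * l :=
    Nat.div_eq_of_eq_mul_right hpp.pos hNp
  have hfix := (hper (N / p) (g₁ + y • g₂)).1 ⟨l, hdiv⟩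
  have heq : y • h p = t p := by
    simp only [h, t]
    rw [smul_comm, eq_neg_iff_add_eq_zero, add_comm, ← smul_add, sub_smul, hfix, one_smul, sub_self]
  by_cases hp : p ∈ T
  · exact hy p hp (hc p y hp heq)
  · have hh : h p = 0 := by
      by_contra h0
      exact hp (Finset.mem_filter.2 ⟨Nat.mem_primeFactors.2 ⟨hpp, hpN, hN.ne'⟩, h0⟩)
    have e1 : Function.minimalPeriod v g₁ ∣ N / p := by
      rw [hper]
      have : t p = 0 := by rw [← heq, hh, smul_zero]
      simp only [t, neg_eq_zero, sub_smul, one_smul] at this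
      exact sub_eq_zero.1 this
    have e2 : Function.minimalPeriod v g₂ ∣ N / p := by
      rw [hper]
      simp only [h, sub_smul, one_smul] at hh
      exact sub_eq_zero.1 hh
    have e3 : N ∣ N / p := Nat.lcm_dvd e1 e2
    have e4 := Nat.le_of_dvd (Nat.div_pos (Nat.le_of_dvd hN hpN) hpp.pos) e3
    exact absurd (Nat.div_lt_self hN hpp.one_lt) (not_lt.2 e4)

lemma key_aut {G : Type*} [AddCommGroup G] (v : AddAut G) (g₁ g₂ : G)
    (h₁ : 0 < Function.minimalPeriod (⇑v) g₁) (h₂ : 0 < Function.minimalPeriod (⇑v) g₂) :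
    ∃ g : G, Function.minimalPeriod (⇑v) g =
      Nat.lcm (Function.minimalPeriod (⇑v) g₁) (Function.minimalPeriod (⇑v) g₂) := by
  let φ : Module.End ℤ G := (AddEquiv.toAddMonoidHom v).toIntLinearMap
  letI : Module (Polynomial ℤ) G :=
    Module.compHom G (Polynomial.aeval φ).toRingHom
  refine key_module (R := Polynomial ℤ) Polynomial.X (⇑v) ?_ g₁ g₂ h₁ h₂
  intro n g
  have : ∀ g : G, (Polynomial.X : Polynomial ℤ) • g = v g := by
    intro g
    change (Polynomial.aeval φ Polynomial.X) g = v g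
    rw [Polynomial.aeval_X]
    rfl
  induction n with
  | zero => simp
  | succ n ih => rw [Function.iterate_succ_apply', ih, pow_succ', mul_smul, this]

/- STATEMENT 1: If `g₁, g₂ ∈ G` have finite `v`-orbits of cardinalities `n₁` and `n₂`,
then some `g ∈ G` has `v`-orbit of cardinality `lcm(n₁,n₂)`; consequently
`L(G,v)` is closed under least common multiples. -/
theorem stmt1 {G : Type*} [AddCommGroup G] (v : AddAut G) :
    (∀ (g₁ g₂ : G) (n₁ n₂ : ℕ), 0 < n₁ → 0 < n₂ →
      Function.minimalPeriod (⇑v) g₁ = n₁ → Function.minimalPeriod (⇑v) g₂ = n₂ →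
      ∃ g : G, Function.minimalPeriod (⇑v) g = Nat.lcm n₁ n₂) ∧
    (∀ n₁ n₂ : ℕ, n₁ ∈ orbitCardSet v → n₂ ∈ orbitCardSet v →
      Nat.lcm n₁ n₂ ∈ orbitCardSet v) := by
  refine ⟨?_, ?_⟩
  · rintro g₁ g₂ n₁ n₂ h₁ h₂ rfl rfl
    exact key_aut v g₁ g₂ h₁ h₂
  · rintro n₁ n₂ ⟨h₁, g₁, hg₁, rfl⟩ ⟨h₂, g₂, hg₂, rfl⟩
    refine ⟨Nat.lcm_pos h₁ h₂, ?_⟩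
    obtain ⟨g, hg⟩ := key_aut v g₁ g₂ h₁ h₂
    by_cases h0 : g = 0
    · have hone : Function.minimalPeriod (⇑v) g = 1 := by
        rw [Function.minimalPeriod_eq_one_iff_isFixedPt, h0]
        exact map_zero v
      refine ⟨g₁, hg₁, ?_⟩
      rw [← hg, hone]
      refine Nat.dvd_one.1 ?_
      rw [← hone, hg]
      exact Nat.dvd_lcm_left _ _
    · exact ⟨g, h0, hg⟩
end

section
/- Let U be a unitary operator on a Hilbert space H and (H_n) a sequence of U-cyclic subspaces such that for every h ∈ H, the distance from h to H_n tends to 0 as n → ∞. Then U has a simple spectrum (i.e., H is a cyclic space for U). -/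
open Filter Topology

/-- The `U`-cyclic subspace generated by `f` : the closure of the linear span of
`{Uⁿ f : n ∈ ℤ}`. -/
noncomputable def cyclicSubspace {H : Type*} [NormedAddCommGroup H] [InnerProductSpace ℂ H]
    (U : H ≃ₗᵢ[ℂ] H) (f : H) : Submodule ℂ H :=
  (Submodule.span ℂ (Set.range fun n : ℤ => (U ^ n) f)).topologicalClosure

/-- `U` has a simple spectrum: the whole space is a `U`-cyclic subspace. -/
def HasSimpleSpectrum {H : Type*} [NormedAddCommGroup H] [InnerProductSpace ℂ H]
    (U : H ≃ₗᵢ[ℂ] H) : Prop :=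
  ∃ f : H, cyclicSubspace U f = ⊤

/-- The operator `∑ cₙ Uⁿ`. -/
noncomputable def laurentOp {H : Type*} [NormedAddCommGroup H] [InnerProductSpace ℂ H]
    (U : H ≃ₗᵢ[ℂ] H) (c : ℤ →₀ ℂ) : H →L[ℂ] H :=
  ∑ n ∈ c.support, c n • ((U ^ n).toContinuousLinearEquiv : H →L[ℂ] H)

section helpers

variable {H : Type*} [NormedAddCommGroup H] [InnerProductSpace ℂ H]

theorem laurentOp_apply (U : H ≃ₗᵢ[ℂ] H) (c : ℤ →₀ ℂ) (x : H) :
    laurentOp U c x = c.sum fun n a => a • (U ^ n) x := by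
  simp [laurentOp, Finsupp.sum]

theorem mem_span_iff_laurent (U : H ≃ₗᵢ[ℂ] H) (x v : H) :
    v ∈ Submodule.span ℂ (Set.range fun n : ℤ => (U ^ n) x) ↔ ∃ c, laurentOp U c x = v := by
  rw [Finsupp.mem_span_range_iff_exists_finsupp]
  simp only [laurentOp_apply]

theorem mem_cyclic_pow (U : H ≃ₗᵢ[ℂ] H) (x v : H) (hv : v ∈ cyclicSubspace U x) (m : ℤ) :
    (U ^ m) v ∈ cyclicSubspace U x := by
  have h1 : Set.MapsTo (U ^ m)
      (Submodule.span ℂ (Set.range fun n : ℤ => (U ^ n) x) : Set H)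
      (Submodule.span ℂ (Set.range fun n : ℤ => (U ^ n) x) : Set H) := by
    intro w hw
    induction hw using Submodule.span_induction with
    | mem w hw =>
      obtain ⟨n, rfl⟩ := hw
      refine Submodule.subset_span ⟨m + n, ?_⟩
      simp [zpow_add]
    | zero => simp
    | add a b _ _ ha hb => rw [map_add]; exact Submodule.add_mem _ ha hb
    | smul a b _ hb => rw [map_smul]; exact Submodule.smul_mem _ a hb
  exact h1.closure (U ^ m).continuous hv

theorem mem_cyclic_self (U : H ≃ₗᵢ[ℂ] H) (x : H) : x ∈ cyclicSubspace U x :=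
  Submodule.le_topologicalClosure _ (Submodule.subset_span ⟨0, by simp⟩)

theorem cyclic_le (U : H ≃ₗᵢ[ℂ] H) (x y : H) (h : y ∈ cyclicSubspace U x) :
    cyclicSubspace U y ≤ cyclicSubspace U x := by
  refine Submodule.topologicalClosure_minimal _ ?_ (Submodule.isClosed_topologicalClosure _)
  rw [Submodule.span_le]
  rintro _ ⟨n, rfl⟩
  exact mem_cyclic_pow U x y h n

theorem laurent_mem (U : H ≃ₗᵢ[ℂ] H) (c : ℤ →₀ ℂ) (K : Submodule ℂ H)
    (hK : ∀ v ∈ K, ∀ m : ℤ, (U ^ m) v ∈ K) (v : H) (hv : v ∈ K) : laurentOp U c v ∈ K := by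
  rw [laurentOp_apply]
  exact Submodule.sum_mem _ fun n _ => K.smul_mem _ (hK v hv n)

theorem orth_pow (U : H ≃ₗᵢ[ℂ] H) (K : Submodule ℂ H)
    (hK : ∀ v ∈ K, ∀ m : ℤ, (U ^ m) v ∈ K) (v : H) (hv : v ∈ Kᗮ) (m : ℤ) :
    (U ^ m) v ∈ Kᗮ := by
  rw [Submodule.mem_orthogonal] at hv ⊢
  intro u hu
  have h := hv _ (hK u hu (-m))
  rw [← (U ^ m).inner_map_map] at h
  rwa [← Function.comp_apply (f := (U ^ m)), ← LinearIsometryEquiv.coe_mul, ← zpow_add,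
    add_neg_cancel, zpow_zero, LinearIsometryEquiv.coe_one, id] at h

variable [CompleteSpace H]

theorem laurent_normal (U : H ≃ₗᵢ[ℂ] H) (c : ℤ →₀ ℂ) : IsStarNormal (laurentOp U c) := by
  have hs : ∀ n : ℤ, star ((U ^ n).toContinuousLinearEquiv : H →L[ℂ] H)
      = ((U ^ (-n)).toContinuousLinearEquiv : H →L[ℂ] H) := by
    intro n
    rw [ContinuousLinearMap.star_eq_adjoint, zpow_neg]
    exact LinearIsometryEquiv.adjoint_eq_symm (U ^ n)
  constructor
  unfold laurentOp
  rw [star_sum]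
  refine Commute.sum_left _ _ _ fun i _ => Commute.sum_right _ _ _ fun j _ => ?_
  rw [star_smul, hs]
  refine Commute.smul_left (Commute.smul_right ?_ _) _
  ext v
  change (U ^ (-i) * U ^ j) v = (U ^ j * U ^ (-i)) v
  rw [← zpow_add, ← zpow_add, add_comm]

theorem eig_orth (T : H →L[ℂ] H) (hT : IsStarNormal T) (s t : ℂ) (hst : s ≠ t) (x y : H)
    (hx : T x = -s • x) (hy : T y = -t • y) : inner ℂ x y = 0 := by
  have hn : IsStarNormal (T + s • (1 : H →L[ℂ] H)) := by
    constructor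
    have h := hT.star_comm_self
    rw [star_add, star_smul, star_one]
    refine Commute.add_left (Commute.add_right h ?_) ?_
    · exact (Commute.one_right _).smul_right _
    · exact (Commute.one_left _).smul_left _
  have h0 : ContinuousLinearMap.adjoint (T + s • (1 : H →L[ℂ] H)) x = 0 := by
    rw [ContinuousLinearMap.IsStarNormal.adjoint_apply_eq_zero_iff hn]
    simp [hx]
  have h1 : inner ℂ (ContinuousLinearMap.adjoint (T + s • (1 : H →L[ℂ] H)) x) y = 0 := by
    rw [h0, inner_zero_left]
  rw [ContinuousLinearMap.adjoint_inner_left] at h1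
  have h2 : (T + s • (1 : H →L[ℂ] H)) y = (s - t) • y := by
    simp [hy, sub_smul]; abel
  rw [h2, inner_smul_right] at h1
  exact (mul_eq_zero.1 h1).resolve_left (sub_ne_zero.2 hst)

theorem eig_countable [TopologicalSpace.SeparableSpace H] (T : H →L[ℂ] H)
    (hT : IsStarNormal T) : {t : ℂ | ∃ y : H, ‖y‖ = 1 ∧ T y = -t • y}.Countable := by
  have hc : ∀ t : {t : ℂ | ∃ y : H, ‖y‖ = 1 ∧ T y = -t • y}, ∃ y : H, ‖y‖ = 1 ∧
    T y = -(t : ℂ) • y := fun t => t.2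
  choose y hy1 hy2 using hc
  rw [← Set.countable_coe_iff]
  refine Pairwise.countable_of_isOpen_disjoint (s := fun t => Metric.ball (y t) (1 / 2)) ?_
    (fun _ => Metric.isOpen_ball) (fun t => ⟨y t, Metric.mem_ball_self (by norm_num)⟩)
  intro s t hst
  refine Metric.ball_disjoint_ball ?_
  have h := eig_orth T hT s t (fun h => hst (Subtype.ext h)) _ _ (hy2 s) (hy2 t)
  have h2 := norm_sub_sq (𝕜 := ℂ) (y s) (y t)
  rw [h, hy1, hy1] at h2
  rw [dist_eq_norm]
  simp at h2
  nlinarith [norm_nonneg (y s - y t)]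

/-- Density of good vectors in a cyclic space. -/
theorem exists_good [TopologicalSpace.SeparableSpace H] (U : H ≃ₗᵢ[ℂ] H) (f : H) (c : ℤ →₀ ℂ)
    (δ : ℝ) (hδ : 0 < δ) : ∃ x : H, dist x (laurentOp U c f) < δ ∧ f ∈ cyclicSubspace U x := by
  have hd := (eig_countable _ (laurent_normal U c)).dense_compl ℂ
  have hopen : IsOpen {t : ℂ | ‖t • f‖ < δ} :=
    isOpen_lt (by fun_prop) continuous_const
  obtain ⟨t, ht1, ht2⟩ := hd.inter_open_nonempty _ hopen ⟨0, by simpa using hδ⟩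
  refine ⟨laurentOp U c f + t • f, by simpa [dist_eq_norm] using ht1, ?_⟩
  set x := laurentOp U c f + t • f with hx
  set K := cyclicSubspace U x with hKdef
  have hKU := mem_cyclic_pow U x
  haveI : CompleteSpace K :=
    (Submodule.isClosed_topologicalClosure _).completeSpace_coe
  set p : H := K.starProjection f with hp
  have hpK : p ∈ K := Submodule.starProjection_apply_mem K f
  have hyK : f - p ∈ Kᗮ := Submodule.sub_starProjection_mem_orthogonal f
  have e : laurentOp U c (f - p) + t • (f - p) = x - (laurentOp U c p + t • p) := by
    rw [map_sub, smul_sub, hx]; abel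
  have m1 : laurentOp U c (f - p) + t • (f - p) ∈ Kᗮ :=
    add_mem (laurent_mem U c _ (orth_pow U K hKU) _ hyK) (Submodule.smul_mem _ _ hyK)
  have m2 : laurentOp U c (f - p) + t • (f - p) ∈ K := by
    rw [e]
    exact sub_mem (mem_cyclic_self U x)
      (add_mem (laurent_mem U c _ hKU _ hpK) (Submodule.smul_mem _ _ hpK))
  have hz : laurentOp U c (f - p) + t • (f - p) = 0 := by
    have := Submodule.inner_right_of_mem_orthogonal m2 m1
    exact inner_self_eq_zero.1 this
  have h0 : f - p = 0 := by
    by_contra hne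
    refine ht2 ⟨((‖f - p‖⁻¹ : ℝ) : ℂ) • (f - p), ?_, ?_⟩
    · rw [norm_smul]
      simp [norm_ne_zero_iff.2 hne]
    · rw [map_smul, eq_neg_of_add_eq_zero_left hz, ← neg_smul, smul_comm]
  rw [sub_eq_zero.1 h0]
  exact hpK

theorem exists_span_near (U : H ≃ₗᵢ[ℂ] H) (x h : H) (ε : ℝ)
    (hε : Metric.infDist h (cyclicSubspace U x : Set H) < ε) :
    ∃ c, dist (laurentOp U c x) h < ε := by
  unfold cyclicSubspace at hε
  rw [Submodule.topologicalClosure_coe, Metric.infDist_closure,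
    Metric.infDist_lt_iff ⟨0, Submodule.zero_mem _⟩] at hε
  obtain ⟨v, hv, hd⟩ := hε
  obtain ⟨c, rfl⟩ := (mem_span_iff_laurent U x v).1 hv
  exact ⟨c, by rwa [dist_comm]⟩

end helpers

/- STATEMENT 6: if `(H_n)` is a sequence of `U`-cyclic subspaces with
`inf_{v ∈ H_n} ‖h − v‖ → 0` for every `h ∈ H`, then `U` has a simple spectrum. -/
theorem stmt6 {H : Type*} [NormedAddCommGroup H] [InnerProductSpace ℂ H] [CompleteSpace H]
    (U : H ≃ₗᵢ[ℂ] H) (f : ℕ → H)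
    (happrox : ∀ h : H,
      Tendsto (fun n => Metric.infDist h (cyclicSubspace U (f n) : Set H)) atTop (𝓝 0)) :
    HasSimpleSpectrum U := by
  haveI : TopologicalSpace.SeparableSpace H := by
    rw [← TopologicalSpace.isSeparable_univ_iff]
    have h1 : TopologicalSpace.IsSeparable (⋃ n, (cyclicSubspace U (f n) : Set H)) := by
      rw [TopologicalSpace.isSeparable_iUnion]
      intro n
      exact ((Set.countable_range fun k : ℤ => (U ^ k) (f n)).isSeparable.span (R := ℂ)).closure
    refine h1.closure.mono fun h _ => ?_
    rw [Metric.mem_closure_iff]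
    intro ε hε
    obtain ⟨n, hn⟩ := ((happrox h).eventually (gt_mem_nhds hε)).exists
    rw [Metric.infDist_lt_iff ⟨0, Submodule.zero_mem _⟩] at hn
    obtain ⟨v, hv, hd⟩ := hn
    exact ⟨v, Set.mem_iUnion.2 ⟨n, hv⟩, hd⟩
  let d := TopologicalSpace.denseSeq H
  let O : ℕ × ℕ → Set H := fun q =>
    ⋃ c : ℤ →₀ ℂ, {x | dist (laurentOp U c x) (d q.1) < 1 / ((q.2 : ℝ) + 1)}
  have hO : ∀ q, IsOpen (O q) := fun q =>
    isOpen_iUnion fun c => isOpen_lt (by fun_prop) continuous_const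
  have hD : ∀ q, Dense (O q) := by
    intro q g
    rw [Metric.mem_closure_iff]
    intro δ hδ
    have hk : (0 : ℝ) < 1 / ((q.2 : ℝ) + 1) := by positivity
    obtain ⟨n, hn1, hn2⟩ := (((happrox g).eventually (gt_mem_nhds (half_pos hδ))).and
      ((happrox (d q.1)).eventually (gt_mem_nhds hk))).exists
    obtain ⟨c, hc⟩ := exists_span_near U _ _ _ hn1
    obtain ⟨x, hx1, hx2⟩ := exists_good U (f n) c _ (half_pos hδ)
    have hle : Metric.infDist (d q.1) (cyclicSubspace U x : Set H) < 1 / ((q.2 : ℝ) + 1) :=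
      (Metric.infDist_le_infDist_of_subset (cyclic_le U x _ hx2)
        ⟨0, Submodule.zero_mem _⟩).trans_lt hn2
    refine ⟨x, Set.mem_iUnion.2 (exists_span_near U _ _ _ hle), ?_⟩
    rw [dist_comm]
    linarith [dist_triangle x (laurentOp U c (f n)) g]
  obtain ⟨x, hx⟩ := (dense_iInter_of_isOpen hO hD).nonempty
  rw [Set.mem_iInter] at hx
  refine ⟨x, ?_⟩
  have hcl : IsClosed (cyclicSubspace U x : Set H) := Submodule.isClosed_topologicalClosure _
  have hsub : ∀ j, d j ∈ cyclicSubspace U x := by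
    intro j
    rw [← SetLike.mem_coe, ← hcl.closure_eq, Metric.mem_closure_iff]
    intro ε hε
    obtain ⟨k, hk⟩ := exists_nat_one_div_lt hε
    obtain ⟨c, hc⟩ := Set.mem_iUnion.1 (hx (j, k))
    refine ⟨laurentOp U c x, Submodule.le_topologicalClosure _
      ((mem_span_iff_laurent U x _).2 ⟨c, rfl⟩), ?_⟩
    rw [dist_comm]
    exact lt_trans hc hk
  rw [eq_top_iff]
  intro h _
  have := closure_minimal (Set.range_subset_iff.2 hsub) hcl
  exact this (TopologicalSpace.denseRange_denseSeq H h)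
end
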